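/- Let X be an m-dimensional vector space over F and Q a nondegenerate quadratic form on X. Then the element Ω = Σ_{x ∈ X} ψ(Q(x)) of 𝒜 satisfies Ω^8 = q^{4m}; in particular Ω is a unit of 𝒜. (This is the non-normalised Weil factor Ω_μ(ψ∘Q) for the counting measure, and it lies in 𝒜^×.) -/

import Mathlib

set_option maxHeartbeats 1000000
set_option synthInstance.maxHeartbeats 1000000

noncomputable section

open scoped TensorProduct

/-! ## The base ring `𝒜`: the integral closure of `ℤ[1/p]` in a cyclotomic field -/

instance cycloAlgebra (p : ℕ) [NeZero p] (m : ℕ+) :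
    Algebra (Localization.Away (p : ℤ)) (CyclotomicField m ℚ) :=
  (Localization.awayLift (algebraMap ℤ (CyclotomicField m ℚ)) _
    (by
      rw [map_natCast]
      have h1 : IsUnit ((p : ℕ) : ℚ) :=
        isUnit_iff_ne_zero.mpr (Nat.cast_ne_zero.mpr (NeZero.ne p))
      have h2 := h1.map (algebraMap ℚ (CyclotomicField m ℚ))
      rwa [map_natCast] at h2)).toAlgebra

/-- The integral closure of `ℤ[1/p]` in the `m`-th cyclotomic field `ℚ(ζ_m)`. -/
def Aint (p : ℕ) [NeZero p] (m : ℕ+) :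
    Subalgebra (Localization.Away (p : ℤ)) (CyclotomicField m ℚ) :=
  integralClosure (Localization.Away (p : ℤ)) (CyclotomicField m ℚ)

/-- The ring `𝒜` associated to a finite field of characteristic `p` : the integral
closure of `ℤ[1/p]` in `ℚ(ζ_p)`. -/
def AA (p : ℕ+) : Type := ↥(Aint (p : ℕ) p)

instance (p : ℕ+) : CommRing (AA p) := inferInstanceAs (CommRing ↥(Aint (p : ℕ) p))

attribute [irreducible] AA

/-! ## The Heisenberg group -/

variable {F : Type*} [Field F] {W : Type*} [AddCommGroup W] [Module F W]

/-- The Heisenberg group attached to the bilinear form `β` : the set `W × F` with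
multiplication `(w,t)(w',t') = (w+w', t+t'+½⟨w,w'⟩)`. -/
@[ext]
structure Heis (β : W →ₗ[F] W →ₗ[F] F) : Type _ where
  w : W
  t : F

namespace Heis

variable {β : W →ₗ[F] W →ₗ[F] F}

instance : Mul (Heis β) :=
  ⟨fun a b => ⟨a.w + b.w, a.t + b.t + (2 : F)⁻¹ * β a.w b.w⟩⟩

instance : One (Heis β) := ⟨⟨0, 0⟩⟩

instance : Inv (Heis β) :=
  ⟨fun a => ⟨-a.w, -a.t + (2 : F)⁻¹ * β a.w a.w⟩⟩

@[simp] lemma mul_w (a b : Heis β) : (a * b).w = a.w + b.w := rfl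
@[simp] lemma mul_t (a b : Heis β) :
    (a * b).t = a.t + b.t + (2 : F)⁻¹ * β a.w b.w := rfl
@[simp] lemma one_w : (1 : Heis β).w = 0 := rfl
@[simp] lemma one_t : (1 : Heis β).t = 0 := rfl
@[simp] lemma inv_w (a : Heis β) : a⁻¹.w = -a.w := rfl
@[simp] lemma inv_t (a : Heis β) :
    a⁻¹.t = -a.t + (2 : F)⁻¹ * β a.w a.w := rfl

instance : Group (Heis β) where
  mul_assoc a b c := by
    ext
    · simp [add_assoc]
    · simp [map_add, LinearMap.add_apply]
      ring
  one_mul a := by ext <;> simp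
  mul_one a := by ext <;> simp
  inv_mul_cancel a := by
    ext
    · simp
    · simp [map_neg, LinearMap.neg_apply]

end Heis

/-! ## The induced representation `V_A^ℬ = ind_{A_H}^H(ψ_A^ℬ)` -/

/-- The compactly induced representation `ind_{A_H}^H ψ_A^ℬ`, realised as the
`ℬ`-submodule of functions `f : H → ℬ` with `f(ah) = ψ_A^ℬ(a) f(h)` for `a ∈ A_H`. -/
def IndV (β : W →ₗ[F] W →ₗ[F] F) (ℬ : Type*) [CommRing ℬ] (A : AddSubgroup W)
    (χ : Heis β → ℬˣ) : Submodule ℬ (Heis β → ℬ) where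
  carrier := {f | ∀ a : Heis β, a.w ∈ A → ∀ h : Heis β, f (a * h) = (χ a : ℬ) * f h}
  add_mem' := by
    intro f g hf hg a ha h
    simp only [Pi.add_apply, hf a ha h, hg a ha h, mul_add]
  zero_mem' := by intro a ha h; simp
  smul_mem' := by
    intro c f hf a ha h
    simp only [Pi.smul_apply, smul_eq_mul, hf a ha h]
    ring

/-- Right translation action of `h₀ ∈ H` on functions `H → ℬ`. -/
def hAct (β : W →ₗ[F] W →ₗ[F] F) (ℬ : Type*) [CommRing ℬ] (h₀ : Heis β) :
    (Heis β → ℬ) →ₗ[ℬ] (Heis β → ℬ) where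
  toFun f := fun h => f (h * h₀)
  map_add' _ _ := rfl
  map_smul' _ _ := rfl

lemma hAct_mem (β : W →ₗ[F] W →ₗ[F] F) (ℬ : Type*) [CommRing ℬ] (A : AddSubgroup W)
    (χ : Heis β → ℬˣ) (h₀ : Heis β) (f : Heis β → ℬ) (hf : f ∈ IndV β ℬ A χ) :
    hAct β ℬ h₀ f ∈ IndV β ℬ A χ := by
  intro a ha h
  simpa [hAct, mul_assoc] using hf a ha (h * h₀)

/-- The action `ρ` of the Heisenberg group on `V_A^ℬ`. -/
def hActV (β : W →ₗ[F] W →ₗ[F] F) (ℬ : Type*) [CommRing ℬ] (A : AddSubgroup W)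
    (χ : Heis β → ℬˣ) (h₀ : Heis β) :
    ↥(IndV β ℬ A χ) →ₗ[ℬ] ↥(IndV β ℬ A χ) :=
  (hAct β ℬ h₀).restrict fun f hf => hAct_mem β ℬ A χ h₀ f hf

/-! ## The symplectic group and its action on the Heisenberg group -/

/-- Action of a linear automorphism `g` on the Heisenberg group: `g·(w,t) = (gw,t)`. -/
def gHeis (β : W →ₗ[F] W →ₗ[F] F) (g : W ≃ₗ[F] W) : Heis β → Heis β :=
  fun h => ⟨g h.w, h.t⟩

/-- The symplectic group `Sp(W)` of the form `β`, as a subgroup of the linear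
automorphism group of `W`. -/
def SpGrp (β : W →ₗ[F] W →ₗ[F] F) : Subgroup (W ≃ₗ[F] W) where
  carrier := {g | ∀ u v : W, β (g u) (g v) = β u v}
  one_mem' := fun _ _ => rfl
  mul_mem' := by
    intro g g' hg hg' u v
    have h : ∀ x, (g * g') x = g (g' x) := fun _ => rfl
    rw [h, h, hg, hg']
  inv_mem' := by
    intro g hg u v
    have h1 := hg (g⁻¹ u) (g⁻¹ v)
    have h2 : ∀ x, g (g⁻¹ x) = x := fun x => g.apply_symm_apply x
    rw [h2, h2] at h1
    exact h1.symm

/-- The defining condition of the metaplectic group over `ℬ` : pairs `(g, M)` with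
`g ∈ Sp(W)` and `M ∘ ρ(h) = ρ(g·h) ∘ M` for all `h ∈ H`. -/
def MetaCond (β : W →ₗ[F] W →ₗ[F] F) (ℬ : Type*) [CommRing ℬ] (A : AddSubgroup W)
    (χ : Heis β → ℬˣ)
    (x : (W ≃ₗ[F] W) × (↥(IndV β ℬ A χ) ≃ₗ[ℬ] ↥(IndV β ℬ A χ))) : Prop :=
  (∀ u v : W, β (x.1 u) (x.1 v) = β u v) ∧
    ∀ (h₀ : Heis β) (f : ↥(IndV β ℬ A χ)),
      x.2 (hActV β ℬ A χ h₀ f) = hActV β ℬ A χ (gHeis β x.1 h₀) (x.2 f)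

/-- The character `ψ_A^ℬ = φ ∘ ψ_A` of `A_H` with values in `ℬˣ`, obtained from a
character with values in `𝒜ˣ` via the structure morphism `φ : 𝒜 → ℬ`. -/
def chB (p : ℕ+) (ℬ : Type*) [CommRing ℬ] [Algebra (AA p) ℬ]
    {β : W →ₗ[F] W →ₗ[F] F} (ψA : Heis β → (AA p)ˣ) : Heis β → ℬˣ :=
  fun h => Units.map (algebraMap (AA p) ℬ).toMonoidHom (ψA h)

/-- The character `ψ^ℬ = φ ∘ ψ` of `F` with values in `ℬˣ`. -/
def psB (p : ℕ+) (ℬ : Type*) [CommRing ℬ] [Algebra (AA p) ℬ]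
    (ψ : F → (AA p)ˣ) : F → ℬˣ :=
  fun t => Units.map (algebraMap (AA p) ℬ).toMonoidHom (ψ t)

theorem Aint_isUnit_natCast (p : ℕ) [NeZero p] (m : ℕ+) : IsUnit (p : Aint p m) := by
  have h : IsUnit (algebraMap ℤ (Localization.Away (p : ℤ)) (p : ℤ)) :=
    IsLocalization.Away.algebraMap_isUnit (p : ℤ)
  simpa using h.map (algebraMap (Localization.Away (p : ℤ)) (Aint p m))

theorem Aint_charZero (p : ℕ) [NeZero p] (m : ℕ+) : CharZero (Aint p m) :=
  by
  refine ⟨fun a b hab => ?_⟩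
  have h := congrArg (Aint p m).val hab
  rw [map_natCast, map_natCast] at h
  exact Nat.cast_injective h

theorem AA_isUnit_natCast (p : ℕ+) : IsUnit ((p : ℕ) : AA p) := by
  have h := Aint_isUnit_natCast (p : ℕ) p
  with_unfolding_all exact h

instance AA_isDomain (p : ℕ+) : IsDomain (AA p) := by
  have h : IsDomain (Aint (p : ℕ) p) := inferInstance
  with_unfolding_all exact h

instance AA_charZero (p : ℕ+) : CharZero (AA p) := by
  have h := Aint_charZero (p : ℕ) p
  with_unfolding_all exact h

theorem map_sum_addChar {ι A R : Type*} [AddCommMonoid A] [CommMonoid R] (ψ : AddChar A R)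
    (s : Finset ι) (f : ι → A) : ψ (∑ i ∈ s, f i) = ∏ i ∈ s, ψ (f i) :=
  map_prod ψ.toMonoidHom (fun i => Multiplicative.ofAdd (f i)) s

theorem sum_addChar_sq_eq_gaussSum {K R : Type*} [Field K] [Fintype K] [DecidableEq K]
    [CommRing R] [IsDomain R] (hK : ringChar K ≠ 2) {ψ : AddChar K R} (hψ : ψ ≠ 1) :
    ∑ x : K, ψ (x ^ 2) = gaussSum ((quadraticChar K).ringHomComp (Int.castRingHom R)) ψ := by
  have hcard (a : K) : ((Finset.univ.filter fun x : K => x ^ 2 = a).card : R) =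
      (quadraticChar K a : R) + 1 := by
    have h := quadraticChar_card_sqrts hK a
    rw [Set.toFinset_ofPred] at h
    exact_mod_cast congrArg (Int.cast : ℤ → R) h
  calc ∑ x : K, ψ (x ^ 2)
      = ∑ a : K, ∑ x : K with x ^ 2 = a, ψ (x ^ 2) :=
        (Finset.sum_fiberwise _ _ _).symm
    _ = ∑ a : K, ((quadraticChar K a : R) * ψ a + ψ a) := by
        refine Finset.sum_congr rfl fun a _ => ?_
        rw [Finset.sum_congr rfl fun x hx => by rw [(Finset.mem_filter.mp hx).2],
          Finset.sum_const, nsmul_eq_mul, hcard]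
        ring
    _ = _ := by
        rw [Finset.sum_add_distrib, AddChar.sum_eq_zero_of_ne_one hψ, add_zero]
        rfl

theorem sum_addChar_sq_pow_four {K R : Type*} [Field K] [Fintype K]
    [CommRing R] [IsDomain R] [CharZero R] (hK : ringChar K ≠ 2) {ψ : AddChar K R}
    (hψ : ψ ≠ 1) : (∑ x : K, ψ (x ^ 2)) ^ 4 = (Fintype.card K : R) ^ 2 := by
  classical
  set χ := (quadraticChar K).ringHomComp (Int.castRingHom R)
  have hχ : χ ≠ 1 :=
    (MulChar.ringHomComp_ne_one_iff Int.cast_injective).mpr (quadraticChar_ne_one hK)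
  have hχq : χ.IsQuadratic := (quadraticChar_isQuadratic K).comp _
  have hneg : χ (-1) ^ 2 = 1 := by rw [← map_pow]; simp
  rw [sum_addChar_sq_eq_gaussSum hK hψ, show 4 = 2 * 2 from rfl, pow_mul,
    gaussSum_sq hχ hχq (AddChar.IsPrimitive.of_ne_one hψ), mul_pow, hneg, one_mul]

theorem sum_addChar_quadraticForm_pow_eight {K R X : Type*} [Field K] [Fintype K]
    [CommRing R] [IsDomain R] [CharZero R] (hK : ringChar K ≠ 2) {ψ : AddChar K R}
    (hψ : ψ ≠ 1) [AddCommGroup X] [Module K X] [FiniteDimensional K X] [Fintype X]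
    (Q : QuadraticForm K X) (hQ : ∀ x : X, (∀ y : X, Q (x + y) = Q x + Q y) → x = 0) :
    (∑ x : X, ψ (Q x)) ^ 8 = (Fintype.card K : R) ^ (4 * Module.finrank K X) := by
  have : Invertible (2 : K) := invertibleOfNonzero (Ring.two_ne_zero hK)
  have hsep : (QuadraticMap.associated (R := K) Q).SeparatingLeft := by
    intro x hx
    refine hQ x fun y => ?_
    have h := LinearMap.congr_fun₂ (QuadraticMap.two_nsmul_associated K Q) x y
    rw [LinearMap.smul_apply, LinearMap.smul_apply, hx y, smul_zero,
      QuadraticMap.polarBilin_apply_apply, QuadraticMap.polar] at h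
    linear_combination -h
  obtain ⟨w, ⟨e⟩⟩ := Q.equivalent_weightedSumSquares_units_of_nondegenerate' hsep
  have hprod : ∑ x : X, ψ (Q x) = ∏ i, ∑ t : K, AddChar.mulShift ψ (w i : K) (t ^ 2) := by
    rw [Finset.prod_univ_sum, Fintype.piFinset_univ, ← e.toLinearEquiv.toEquiv.sum_comp]
    refine Finset.sum_congr rfl fun x _ => ?_
    rw [← e.map_app x, QuadraticMap.weightedSumSquares_apply, map_sum_addChar]
    refine Finset.prod_congr rfl fun i _ => ?_
    rw [AddChar.mulShift_apply, pow_two, Units.smul_def, smul_eq_mul]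
    rfl
  have hshift (i) : AddChar.mulShift ψ (w i : K) ≠ 1 :=
    AddChar.IsPrimitive.of_ne_one hψ (w i).ne_zero
  rw [hprod, ← Finset.prod_pow]
  have h8 (i) : (∑ t : K, AddChar.mulShift ψ (w i : K) (t ^ 2)) ^ 8 =
      (Fintype.card K : R) ^ 4 := by
    rw [show 8 = 4 * 2 from rfl, pow_mul, sum_addChar_sq_pow_four hK (hshift i), ← pow_mul]
  simp only [h8, Finset.prod_const, Finset.card_univ, Fintype.card_fin, pow_mul]

/-- Let `X` be an `m`-dimensional `F`-vector space and `Q` a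
nondegenerate quadratic form on `X`. The non-normalised Weil factor
`Ω = Σ_{x ∈ X} ψ(Q(x)) ∈ 𝒜` (for the counting measure) satisfies `Ω^8 = q^{4m}`;
in particular `Ω` is a unit of `𝒜`. -/
theorem statement_11
    (p : ℕ+) [Fact (Nat.Prime (p : ℕ))] (hp2 : (p : ℕ) ≠ 2)
    {F : Type*} [Field F] [Fintype F] [CharP F (p : ℕ)]
    (ψ : F → (AA p)ˣ) (hψ : ∀ x y : F, ψ (x + y) = ψ x * ψ y)
    (hψnt : ∃ x : F, ψ x ≠ 1)
    {X : Type*} [AddCommGroup X] [Module F X] [FiniteDimensional F X] [Fintype X]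
    (Q : QuadraticForm F X)
    (hQ : ∀ x : X, (∀ y : X, Q (x + y) = Q x + Q y) → x = 0) :
    (∑ x : X, ((ψ (Q x) : (AA p)ˣ) : AA p)) ^ 8 =
        (Fintype.card F : AA p) ^ (4 * Module.finrank F X) ∧
      IsUnit (∑ x : X, ((ψ (Q x) : (AA p)ˣ) : AA p)) := by
  have hK : ringChar F ≠ 2 := by rwa [ringChar.eq F (p : ℕ)]
  have hzero : ψ 0 = 1 := by simpa using hψ 0 0
  let ψ' : AddChar F (AA p) :=
    { toFun := fun x => (ψ x : AA p)
      map_zero_eq_one' := by rw [hzero, Units.val_one]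
      map_add_eq_mul' := fun x y => by rw [hψ, Units.val_mul] }
  have hψ' : ψ' ≠ 1 := by
    obtain ⟨x, hx⟩ := hψnt
    exact AddChar.ne_one_iff.mpr ⟨x, fun h => hx (Units.ext h)⟩
  have hpow : (∑ x : X, ((ψ (Q x) : (AA p)ˣ) : AA p)) ^ 8 =
      (Fintype.card F : AA p) ^ (4 * Module.finrank F X) :=
    sum_addChar_quadraticForm_pow_eight hK hψ' Q hQ
  refine ⟨hpow, (isUnit_pow_iff (by norm_num : (8 : ℕ) ≠ 0)).mp ?_⟩
  obtain ⟨n, -, hn⟩ := FiniteField.card F (p : ℕ)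
  rw [hpow, hn, Nat.cast_pow]
  exact ((AA_isUnit_natCast p).pow _).pow _
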